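/- arXiv:1706.00042 — 3 statements merged into one kernel-verified Lean document; each statement's English description precedes it below -/
import Mathlib

section
/- Let G be an abelian group and let A be a finite subset of G \ {0} with |A| = 8 such that A contains no 2-subset {x, -x} and the sum of all elements of A is 0. Then there exists an ordering of the elements of A whose partial sums are pairwise distinct. -/
/-- Search for a choice of one element from each clause whose elements are pairwise related by `r`,
branching on a shortest clause; the value `true` certifies that there is no such choice. -/
def refuteClauses (r : ℕ → ℕ → Bool) : ℕ → List (List ℕ) → Bool
  | 0, _ => false
  | _ + 1, [] => false
  | n + 1, c :: cs =>
    (cs.foldl (fun d e => bif Nat.ble d.length e.length then d else e) c).all fun m =>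
      refuteClauses r n (((c :: cs).filter fun d => !d.any (Nat.beq m)).map fun d => d.filter (r m))

theorem foldl_shortest_mem (cs : List (List ℕ)) (c : List ℕ) :
    cs.foldl (fun d e => bif Nat.ble d.length e.length then d else e) c ∈ c :: cs := by
  induction cs generalizing c with
  | nil => simp
  | cons e cs ih =>
    have h := ih (bif Nat.ble c.length e.length then c else e)
    rw [List.foldl_cons]
    cases hb : Nat.ble c.length e.length <;>
      simp only [hb, cond_true, cond_false] at h ⊢ <;> simp only [List.mem_cons] at h ⊢ <;> tauto

theorem exists_clause_of_refuteClauses {r : ℕ → ℕ → Bool} {P : ℕ → Prop}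
    (hP : ∀ m m', P m → P m' → r m m' = true) (n : ℕ) (cs : List (List ℕ))
    (h : refuteClauses r n cs = true) : ∃ c ∈ cs, ∀ m ∈ c, ¬ P m := by
  induction n generalizing cs with
  | zero => simp [refuteClauses] at h
  | succ n ih =>
    cases cs with
    | nil => simp [refuteClauses] at h
    | cons c cs =>
      by_contra! hcon
      obtain ⟨m, hm, hPm⟩ := hcon _ (foldl_shortest_mem cs c)
      rw [refuteClauses, List.all_eq_true] at h
      obtain ⟨d, hd, hdP⟩ := ih _ (h m hm)
      obtain ⟨e, he, rfl⟩ := List.mem_map.1 hd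
      obtain ⟨m', hm', hPm'⟩ := hcon e (List.mem_of_mem_filter he)
      exact hdP m' (List.mem_filter.2 ⟨hm', hP m m' hPm hPm'⟩) hPm'

/-- Two subsets of an 8-element set, encoded in binary, may both have sum zero. The binary digits
equal to one in the constant are those at the numbers below 256 of binary weight 0, 3, 4, 5 or 8. -/
def compatible (m k : ℕ) : Bool :=
  Nat.beq
    ((58389157116285103005000993125707066667102752311444012407400597394374959622273 >>>
      (m ^^^ k)) % 2) 1

/-- The binary encoding of a list without repetitions. -/
def listMask (l : List (Fin 8)) : ℕ :=
  l.foldr (fun i m => 2 ^ i.val ^^^ m) 0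

/-- The encodings of the proper segments of a list that avoid its first entry, restricted to those
that may have sum zero. -/
def segmentMasks (o : List (Fin 8)) : List ℕ :=
  ((List.range 8).flatMap fun j => (List.range j).map fun i =>
    listMask ((o.take (j + 1)).drop (i + 1))).filter (compatible 0)

/-- The images of one ordering of `ℤ/7 ∪ {∞}` (with `∞` written as `7`) under the affine group. -/
def affineOrders : List (List (Fin 8)) :=
  (List.range 6).flatMap fun s => (List.range 7).map fun t =>
    7 :: [0, 1, 2, 6, 3, 5, 4].map fun x => Fin.ofNat 8 (((s + 1) * x + t) % 7)

theorem refuteClauses_affineOrders :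
    refuteClauses compatible 9 (affineOrders.map segmentMasks) = true := by
  decide +kernel

theorem nodup_of_mem_affineOrders :
    ∀ o ∈ affineOrders, o.Nodup ∧ o.length = 8 := by
  decide +kernel

theorem incompatible_cases : ∀ x < 256, compatible 0 x = false → ∃ i : Fin 8,
    x = 2 ^ i.val ∨ x = 2 ^ i.val ^^^ 255 ∨
    ∃ j : Fin 8, i ≠ j ∧ (x = 2 ^ i.val ^^^ 2 ^ j.val ∨ x = 2 ^ i.val ^^^ 2 ^ j.val ^^^ 255) := by
  decide +kernel

section MaskSum

variable {G : Type*} [AddCommGroup G]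

/-- The sum of the values of `a` over the subset encoded by `m`. -/
def maskSum (a : Fin 8 → G) (m : ℕ) : G :=
  ∑ i, if m.testBit i.val then a i else 0

theorem maskSum_zero (a : Fin 8 → G) : maskSum a 0 = 0 := by
  simp [maskSum]

theorem maskSum_xor_two_pow (a : Fin 8 → G) (m : ℕ) (i : Fin 8) :
    maskSum a (m ^^^ 2 ^ i.val) = maskSum a m + if m.testBit i.val then -a i else a i := by
  rw [← sub_eq_iff_eq_add', maskSum, maskSum, ← Finset.sum_sub_distrib,
    Finset.sum_eq_single i]
  · cases h : m.testBit i.val <;> simp [Nat.testBit_xor, h]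
  · intro k _ hk
    have : ¬ i.val = k.val := fun h => hk (Fin.ext h.symm)
    simp [Nat.testBit_xor, this]
  · simp

theorem maskSum_xor_full (a : Fin 8 → G) (ha : ∑ i, a i = 0) (m : ℕ) :
    maskSum a (m ^^^ 255) = -maskSum a m := by
  rw [eq_neg_iff_add_eq_zero, maskSum, maskSum, ← Finset.sum_add_distrib]
  refine (Finset.sum_congr rfl fun i _ => ?_).trans ha
  have : Nat.testBit 255 i.val = true := by revert i; decide
  cases h : m.testBit i.val <;> simp [Nat.testBit_xor, h, this]

theorem testBit_listMask (l : List (Fin 8)) (hl : l.Nodup) (i : Fin 8) :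
    (listMask l).testBit i.val = decide (i ∈ l) := by
  induction l with
  | nil => simp [listMask]
  | cons k l ih =>
    rw [List.nodup_cons] at hl
    have h := ih hl.2
    rw [listMask] at h
    rw [listMask, List.foldr_cons, Nat.testBit_xor, h, Nat.testBit_two_pow]
    by_cases hik : i = k
    · subst hik
      simp [hl.1]
    · have : ¬ k.val = i.val := fun h => hik (Fin.ext h.symm)
      simp [hik, this]

theorem maskSum_listMask (a : Fin 8 → G) (l : List (Fin 8)) (hl : l.Nodup) :
    maskSum a (listMask l) = (l.map a).sum := by
  rw [← List.sum_toFinset a hl, maskSum]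
  simp [testBit_listMask l hl, Finset.sum_ite_mem, ← List.mem_toFinset]

theorem listMask_lt (l : List (Fin 8)) : listMask l < 256 := by
  induction l with
  | nil => simp [listMask]
  | cons k l ih =>
    have hk : 2 ^ k.val < 2 ^ 8 := Nat.pow_lt_pow_right (by norm_num) k.isLt
    exact Nat.xor_lt_two_pow (n := 8) hk ih

theorem compatible_of_maskSum_eq_zero {a : Fin 8 → G} (ha : Function.Injective a)
    (h0 : ∀ i, a i ≠ 0) (hpair : ∀ i j, a i + a j = 0 → i = j) (hsum : ∑ i, a i = 0)
    {m m' : ℕ} (hlt : m < 256) (hlt' : m' < 256)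
    (hm : maskSum a m = 0) (hm' : maskSum a m' = 0) : compatible m m' = true := by
  have key (i : Fin 8) : maskSum a (m ^^^ 2 ^ i.val) ≠ 0 := by
    rw [maskSum_xor_two_pow, hm]
    split_ifs <;> simp [h0]
  have key₂ (i j : Fin 8) (hij : i ≠ j) : maskSum a (m ^^^ (2 ^ i.val ^^^ 2 ^ j.val)) ≠ 0 := by
    rw [← Nat.xor_assoc, maskSum_xor_two_pow, maskSum_xor_two_pow, hm]
    intro h
    split_ifs at h
    · refine hij (hpair i j (neg_eq_zero.1 ?_))
      rw [← h]; abel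
    · refine hij (ha ?_)
      rw [← sub_eq_zero, ← neg_eq_zero, ← h]; abel
    · refine hij (ha ?_)
      rw [← sub_eq_zero, ← h]; abel
    · refine hij (hpair i j ?_)
      rw [← h]; abel
  by_contra hc
  have hx : m' = m ^^^ (m ^^^ m') := (Nat.xor_xor_cancel_left m m').symm
  have hc' : compatible 0 (m ^^^ m') = false := by
    rw [Bool.eq_false_iff]
    simpa only [compatible, Nat.zero_xor] using hc
  obtain ⟨i, h | h | ⟨j, hij, h | h⟩⟩ :=
    incompatible_cases _ (Nat.xor_lt_two_pow (n := 8) hlt hlt') hc' <;> rw [h] at hx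
  · exact key i (hx ▸ hm')
  · rw [hx, ← Nat.xor_assoc, maskSum_xor_full a hsum, neg_eq_zero] at hm'
    exact key i hm'
  · exact key₂ i j hij (hx ▸ hm')
  · rw [hx, ← Nat.xor_assoc, maskSum_xor_full a hsum, neg_eq_zero] at hm'
    exact key₂ i j hij hm'

theorem exists_order_segments_ne_zero {a : Fin 8 → G} (ha : Function.Injective a)
    (h0 : ∀ i, a i ≠ 0) (hpair : ∀ i j, a i + a j = 0 → i = j) (hsum : ∑ i, a i = 0) :
    ∃ o : List (Fin 8), o.Nodup ∧ o.length = 8 ∧ ∀ i j, i < j → j < 8 →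
      (((o.take (j + 1)).drop (i + 1)).map a).sum ≠ 0 := by
  obtain ⟨c, hc, hcP⟩ := exists_clause_of_refuteClauses
    (P := fun m => m < 256 ∧ maskSum a m = 0)
    (fun m m' hm hm' => compatible_of_maskSum_eq_zero ha h0 hpair hsum hm.1 hm'.1 hm.2 hm'.2)
    _ _ refuteClauses_affineOrders
  obtain ⟨o, ho, rfl⟩ := List.mem_map.1 hc
  obtain ⟨hnd, hlen⟩ := nodup_of_mem_affineOrders o ho
  refine ⟨o, hnd, hlen, fun i j hij hj hzero => ?_⟩
  have hseg : ((o.take (j + 1)).drop (i + 1)).Nodup :=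
    hnd.sublist ((List.drop_sublist _ _).trans (List.take_sublist _ _))
  rw [← maskSum_listMask a _ hseg] at hzero
  refine hcP _ (List.mem_filter.2 ⟨?_, ?_⟩) ⟨listMask_lt _, hzero⟩
  · exact List.mem_flatMap.2 ⟨j, List.mem_range.2 hj, List.mem_map.2 ⟨i, List.mem_range.2 hij, rfl⟩⟩
  · exact compatible_of_maskSum_eq_zero ha h0 hpair hsum (by norm_num) (listMask_lt _)
      (maskSum_zero a) hzero

theorem sum_take_ne_of_segments_ne_zero {l : List G}
    (h : ∀ i j, i < j → j < l.length → ((l.take (j + 1)).drop (i + 1)).sum ≠ 0)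
    {i j : ℕ} (hij : i < j) (hj : j < l.length) :
    (l.take (i + 1)).sum ≠ (l.take (j + 1)).sum := by
  intro heq
  have hsplit := List.sum_take_add_sum_drop (l.take (j + 1)) (i + 1)
  rw [List.take_take, min_eq_left (by omega), heq, add_eq_left] at hsplit
  exact h i j hij hj hsplit

end MaskSum

theorem stmt_4 {G : Type*} [AddCommGroup G] [DecidableEq G] (A : Finset G)
    (h0 : (0 : G) ∉ A)
    (hpair : ∀ x ∈ A, -x ∈ A → x = -x)
    (hsum : ∑ a ∈ A, a = 0)
    (hcard : A.card = 8) :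
    ∃ l : List G, l.Nodup ∧ l.toFinset = A ∧
      ∀ i j : Fin l.length,
        (l.take (i.1 + 1)).sum = (l.take (j.1 + 1)).sum → i = j := by
  let e : Fin 8 ≃ A := (A.equivFinOfCardEq hcard).symm
  let a : Fin 8 → G := fun i => e i
  have ha : Function.Injective a := Subtype.val_injective.comp e.injective
  have hmem (i : Fin 8) : a i ∈ A := (e i).2
  have hpair' (i j : Fin 8) (hij : a i + a j = 0) : i = j := by
    have hj : a j = -a i := eq_neg_of_add_eq_zero_right hij
    exact ha ((hpair _ (hmem i) (hj ▸ hmem j)).trans hj.symm)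
  have hsum' : ∑ i, a i = 0 := by
    rw [← hsum, ← Finset.sum_coe_sort A]
    exact e.sum_comp fun x : A => (x : G)
  obtain ⟨o, hnd, hlen, hseg⟩ := exists_order_segments_ne_zero ha
    (fun i hi => h0 (hi ▸ hmem i)) hpair' hsum'
  have hnd' : (o.map a).Nodup := hnd.map ha
  have hlen' : (o.map a).length = 8 := by rw [List.length_map, hlen]
  refine ⟨o.map a, hnd', ?_, fun i j hij => ?_⟩
  · refine Finset.eq_of_subset_of_card_le (fun x hx => ?_) ?_
    · obtain ⟨i, -, rfl⟩ := List.mem_map.1 (List.mem_toFinset.1 hx)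
      exact hmem i
    · rw [List.toFinset_card_of_nodup hnd', hlen', hcard]
  · have hne {i j : ℕ} := sum_take_ne_of_segments_ne_zero (l := o.map a) (i := i) (j := j)
      fun i j hij hj => by
        rw [← List.map_take, ← List.map_drop]
        exact hseg i j hij (hlen' ▸ hj)
    rcases lt_trichotomy i.val j.val with h | h | h
    · exact absurd hij (hne h j.isLt)
    · exact Fin.ext h
    · exact absurd hij.symm (hne h i.isLt)
end

section
/- Let G be an abelian group and let A be a finite subset of G \ {0} with |A| = 9 such that A contains no 2-subset {x, -x} and the sum of all elements of A is 0. Then there exists an ordering of the elements of A whose partial sums are pairwise distinct. -/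
/-! A set `A` of nine elements with sum zero is enumerated by `0, …, 8`, and a subset of it is encoded
by a bit mask below `2 ^ 9`. As `A` has neither zero nor a pair of distinct opposite elements, two
zero-sum subsets never differ in `1`, `2`, `7` or `8` places. A decision tree that branches on
whether a given subset has sum zero, and applies this rule along the way, finds an ordering of `A`
none of whose intervals has sum zero. -/

namespace SimpleOrdering

open Finset

section ZeroSum

variable {ι G : Type*} [DecidableEq ι] [AddCommGroup G]

/-- Two zero-sum families of a set without zero and without opposite pairs do not differ in exactly
one or two places. -/
lemma card_symmDiff_ne {f : ι → G} {U S Z : Finset ι} (hne : ∀ i ∈ U, f i ≠ 0)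
    (hinj : ∀ i ∈ U, ∀ j ∈ U, i ≠ j → f i ≠ f j)
    (hneg : ∀ i ∈ U, ∀ j ∈ U, i ≠ j → f i + f j ≠ 0)
    (hS : S ⊆ U) (hZ : Z ⊆ U) (hS0 : ∑ i ∈ S, f i = 0) (hZ0 : ∑ i ∈ Z, f i = 0) :
    (symmDiff S Z).card ≠ 1 ∧ (symmDiff S Z).card ≠ 2 := by
  have hd : ∑ i ∈ S \ Z, f i = ∑ i ∈ Z \ S, f i := by
    have h₁ := sum_inter_add_sum_sdiff S Z f
    have h₂ := sum_inter_add_sum_sdiff Z S f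
    rw [inter_comm Z S] at h₂
    exact add_left_cancel (h₁.trans (hS0.trans (hZ0.symm.trans h₂.symm)))
  have hdisj : Disjoint (S \ Z) (Z \ S) := disjoint_sdiff_sdiff
  have hcard : (symmDiff S Z).card = (S \ Z).card + (Z \ S).card := by
    rw [symmDiff_def, sup_eq_union, card_union_of_disjoint hdisj]
  have hSU : ∀ i ∈ S \ Z, i ∈ U := fun i hi => hS (mem_sdiff.1 hi).1
  have hZU : ∀ i ∈ Z \ S, i ∈ U := fun i hi => hZ (mem_sdiff.1 hi).1
  rw [hcard]
  generalize S \ Z = P at *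
  generalize Z \ S = Q at *
  have single : ∀ R : Finset ι, (∀ i ∈ R, i ∈ U) → R.card = 1 → ∑ i ∈ R, f i ≠ 0 := by
    intro R hR h1
    obtain ⟨x, rfl⟩ := card_eq_one.1 h1
    simpa using hne x (hR x (by simp))
  have pair : ∀ R : Finset ι, (∀ i ∈ R, i ∈ U) → R.card = 2 → ∑ i ∈ R, f i ≠ 0 := by
    intro R hR h2
    obtain ⟨x, y, hxy, rfl⟩ := card_eq_two.1 h2
    rw [sum_pair hxy]
    exact hneg x (hR x (by simp)) y (hR y (by simp)) hxy
  have nil : ∀ R : Finset ι, R.card = 0 → ∑ i ∈ R, f i = 0 := by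
    intro R h
    rw [card_eq_zero.1 h, sum_empty]
  refine ⟨fun h => ?_, fun h => ?_⟩
  · obtain ⟨hp, hq⟩ | ⟨hp, hq⟩ : P.card = 1 ∧ Q.card = 0 ∨ P.card = 0 ∧ Q.card = 1 := by omega
    · exact single P hSU hp (hd.trans (nil Q hq))
    · exact single Q hZU hq (hd.symm.trans (nil P hp))
  · obtain ⟨hp, hq⟩ | ⟨hp, hq⟩ | ⟨hp, hq⟩ :
        P.card = 2 ∧ Q.card = 0 ∨ P.card = 0 ∧ Q.card = 2 ∨ P.card = 1 ∧ Q.card = 1 := by omega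
    · exact pair P hSU hp (hd.trans (nil Q hq))
    · exact pair Q hZU hq (hd.symm.trans (nil P hp))
    · obtain ⟨x, rfl⟩ := card_eq_one.1 hp
      obtain ⟨y, rfl⟩ := card_eq_one.1 hq
      have hxy : x ≠ y := by simpa using hdisj
      exact hinj x (hSU x (by simp)) y (hZU y (by simp)) hxy (by simpa using hd)

end ZeroSum

section Mask

/-- The subset of `{0, …, 8}` encoded by `m`. -/
def support (m : ℕ) : Finset ℕ := (range 9).filter fun i => m.testBit i

/-- The number of elements of the subset encoded by `m`. -/
def weight (m : ℕ) : ℕ := (support m).card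

/-- The bit mask that encodes the set of members of `p`. -/
def mask : List ℕ → ℕ
  | [] => 0
  | i :: p => 2 ^ i ||| mask p

lemma support_subset (m : ℕ) : support m ⊆ range 9 := filter_subset _ _

lemma support_xor (a b : ℕ) : support (a ^^^ b) = symmDiff (support a) (support b) := by
  ext i
  simp only [support, mem_filter, mem_symmDiff, Nat.testBit_xor]
  cases a.testBit i <;> cases b.testBit i <;> simp

lemma support_511 : support 511 = range 9 := by decide

lemma testBit_mask (p : List ℕ) (k : ℕ) : (mask p).testBit k = true ↔ k ∈ p := by
  induction p with
  | nil => simp [mask]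
  | cons i p ih => simp [mask, Nat.testBit_or, Nat.testBit_two_pow, ih, @eq_comm _ k]

lemma support_mask {p : List ℕ} (hp : ∀ i ∈ p, i < 9) : support (mask p) = p.toFinset := by
  ext i
  simp only [support, mem_filter, mem_range, testBit_mask, List.mem_toFinset]
  exact ⟨And.right, fun h => ⟨hp i h, h⟩⟩

/-- Two distinct zero-sum subsets cannot be this close to each other or to being complementary. -/
def close (a b : ℕ) : Bool := weight (a ^^^ b) ∈ [1, 2, 7, 8]

/-- The two masks encode the same subset or complementary subsets of `{0, …, 8}`. -/
def same (a b : ℕ) : Bool := weight (a ^^^ b) ∈ [0, 9]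

end Mask

/-- A decision tree: `split m c d` continues with `c` or `d` according to whether the subset encoded
by `m` has sum zero, and `leaf n` proposes the ordering whose members, increased by one, are the
decimal digits of `n`. -/
inductive Tree
  | leaf (n : ℕ)
  | split (m : ℕ) (c d : Tree)

/-- The lowest `k` decimal digits of `n`, each decreased by one. -/
def digits : ℕ → ℕ → List ℕ
  | 0, _ => []
  | k + 1, n => (n % 10 - 1) :: digits k (n / 10)

/-- The members of `p` in the positions `i + 1, …, j`. -/
def interval (p : List ℕ) (i j : ℕ) : List ℕ := (p.take (j + 1)).drop (i + 1)

/-- All orderings in the decision tree are valid, where `ex` recognises subsets that are known not to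
have sum zero. -/
def Tree.check : Tree → (ℕ → Bool) → Bool
  | leaf n, ex =>
    let p := digits 9 n
    decide p.Nodup && p.all (· < 9) &&
      (List.range 9).all fun j => (List.range j).all fun i => ex (mask (interval p i j))
  | split m c d, ex => c.check (fun x => ex x || close m x) && d.check fun x => ex x || same m x

section Search

variable {G : Type*} [AddCommGroup G] {f : ℕ → G}

/-- The hypotheses on the enumeration `f 0, …, f 8` of the given set. -/
structure Admissible (f : ℕ → G) : Prop where
  ne_zero : ∀ i ∈ range 9, f i ≠ 0
  ne : ∀ i ∈ range 9, ∀ j ∈ range 9, i ≠ j → f i ≠ f j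
  add_ne_zero : ∀ i ∈ range 9, ∀ j ∈ range 9, i ≠ j → f i + f j ≠ 0
  sum_eq_zero : ∑ i ∈ range 9, f i = 0

/-- The sum of the subset encoded by `m`. -/
def maskSum (f : ℕ → G) (m : ℕ) : G := ∑ i ∈ support m, f i

lemma maskSum_mask {p : List ℕ} (hp : ∀ i ∈ p, i < 9) (hn : p.Nodup) :
    maskSum f (mask p) = (p.map f).sum := by
  rw [maskSum, support_mask hp, List.sum_toFinset f hn]

lemma support_xor_511 (m : ℕ) : support (m ^^^ 511) = range 9 \ support m := by
  rw [support_xor, support_511, symmDiff_of_le (support_subset m)]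

lemma Admissible.maskSum_compl (hf : Admissible f) (m : ℕ) :
    maskSum f (m ^^^ 511) = -maskSum f m := by
  have h := sum_sdiff (f := f) (support_subset m)
  rw [hf.sum_eq_zero] at h
  rw [maskSum, support_xor_511]
  exact eq_neg_of_add_eq_zero_left h

lemma weight_compl (a b : ℕ) : weight (a ^^^ (b ^^^ 511)) + weight (a ^^^ b) = 9 := by
  rw [← Nat.xor_assoc, weight, weight, support_xor_511,
    card_sdiff_add_card_eq_card (support_subset _), card_range]

lemma Admissible.ne_zero_of_close (hf : Admissible f) {a b : ℕ} (ha : maskSum f a = 0)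
    (hab : close a b = true) : maskSum f b ≠ 0 := by
  intro hb
  have key : ∀ c, maskSum f c = 0 → weight (a ^^^ c) ≠ 1 ∧ weight (a ^^^ c) ≠ 2 := by
    intro c hc
    rw [weight, support_xor]
    exact card_symmDiff_ne hf.ne_zero hf.ne hf.add_ne_zero (support_subset a) (support_subset c)
      ha hc
  have h₁ := key b hb
  have h₂ := key (b ^^^ 511) (by rw [hf.maskSum_compl, hb, neg_zero])
  have h₃ := weight_compl a b
  simp only [close, List.mem_cons, List.not_mem_nil, or_false, decide_eq_true_eq] at hab
  omega

lemma Admissible.ne_zero_of_close_zero (hf : Admissible f) {m : ℕ}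
    (hm : close 0 m = true) : maskSum f m ≠ 0 :=
  hf.ne_zero_of_close (by simp [maskSum, support]) hm

lemma Admissible.ne_zero_of_same (hf : Admissible f) {a b : ℕ} (ha : maskSum f a ≠ 0)
    (hab : same a b = true) : maskSum f b ≠ 0 := by
  have key : ∀ c, weight (a ^^^ c) = 0 → maskSum f c = maskSum f a := by
    intro c hc
    rw [weight, support_xor, card_eq_zero, ← bot_eq_empty, symmDiff_eq_bot] at hc
    rw [maskSum, maskSum, hc]
  have h := weight_compl a b
  simp only [same, List.mem_cons, List.not_mem_nil, or_false, decide_eq_true_eq] at hab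
  rcases hab with h0 | h9
  · rwa [key b h0]
  · rw [← neg_ne_zero, ← hf.maskSum_compl, key _ (by omega)]
    exact ha

/-- If a decision tree is valid, then one of its orderings has no interval with sum zero. -/
lemma Admissible.exists_ordering (hf : Admissible f) (t : Tree) {ex : ℕ → Bool}
    (hex : ∀ m, ex m = true → maskSum f m ≠ 0) (ht : t.check ex = true) :
    ∃ p : List ℕ, p.length = 9 ∧ p.Nodup ∧ (∀ i ∈ p, i < 9) ∧
      ∀ j < 9, ∀ i < j, maskSum f (mask (interval p i j)) ≠ 0 := by
  induction t generalizing ex with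
  | leaf n =>
    simp only [Tree.check, Bool.and_eq_true, decide_eq_true_eq, List.all_eq_true,
      List.mem_range] at ht
    exact ⟨digits 9 n, rfl, ht.1.1, ht.1.2, fun j hj i hi => hex _ (ht.2 j hj i hi)⟩
  | split m c d hc hd =>
    simp only [Tree.check, Bool.and_eq_true] at ht
    by_cases hm : maskSum f m = 0
    · refine hc (fun x hx => ?_) ht.1
      exact (Bool.or_eq_true_iff.1 hx).elim (hex x) (hf.ne_zero_of_close hm)
    · refine hd (fun x hx => ?_) ht.2
      exact (Bool.or_eq_true_iff.1 hx).elim (hex x) (hf.ne_zero_of_same hm)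

end Search

/-- A valid decision tree for the case that the first three elements have sum zero. -/
def tripleTree : Tree :=
  .split 29 (.split 44 (.split 148 (.leaf 126785439) (.leaf 129764538)) (.split 163 (.split 208
  (.leaf 126784539) (.leaf 129875436)) (.split 195 (.split 137 (.leaf 124876935) (.split 54
  (.leaf 135947826) (.leaf 142356978))) (.split 280 (.split 387 (.leaf 124986735) (.leaf
  128975436)) (.split 336 (.split 76 (.leaf 126874539) (.leaf 128695437)) (.leaf 128795436))))))
  (.split 81 (.split 162 (.split 323 (.leaf 134567829) (.split 180 (.leaf 135768429) (.split 152
  (.leaf 174568329) (.leaf 174586329)))) (.split 224 (.split 449 (.leaf 128364579) (.split 54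
  (.leaf 125736849) (.split 42 (.leaf 152364879) (.leaf 153264879)))) (.split 226 (.split 140
  (.leaf 125786439) (.leaf 128349576)) (.split 269 (.split 104 (.leaf 135286497) (.leaf
  154768239)) (.split 290 (.leaf 139286754) (.leaf 139268754)))))) (.split 85 (.split 276
  (.split 100 (.leaf 124695738) (.leaf 128495736)) (.split 88 (.split 43 (.leaf 125468937)
  (.leaf 126487539)) (.split 163 (.split 97 (.leaf 127684935) (.split 30 (.leaf 135976824)
  (.leaf 168945327))) (.split 200 (.split 148 (.leaf 124687539) (.leaf 126947538)) (.split 291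
  (.split 224 (.leaf 128647539) (.leaf 124687539)) (.leaf 126847539)))))) (.split 266 (.split
  142 (.split 146 (.leaf 134268579) (.leaf 135284976)) (.split 170 (.split 97 (.leaf 124395768)
  (.leaf 163284957)) (.split 336 (.split 354 (.leaf 126948537) (.split 148 (.leaf 134269785)
  (.leaf 135879624))) (.split 337 (.split 56 (.leaf 127948635) (.leaf 138645927)) (.split 352
  (.leaf 138246957) (.leaf 138246975)))))) (.split 270 (.split 26 (.split 322 (.leaf 134269758)
  (.leaf 139274586)) (.split 101 (.split 76 (.leaf 125943876) (.split 51 (.leaf 124586739)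
  (.leaf 127349856))) (.split 392 (.split 417 (.leaf 125349786) (.leaf 168954237)) (.split 416
  (.split 152 (.leaf 142369785) (.leaf 136294857)) (.leaf 135249867))))) (.split 290 (.split 78
  (.split 224 (.leaf 134267985) (.leaf 134297685)) (.split 176 (.split 170 (.leaf 124697538)
  (.split 277 (.leaf 124785369) (.leaf 139246875))) (.split 177 (.split 146 (.split 448 (.leaf
  124378596) (.leaf 134798625)) (.leaf 134796528)) (.split 145 (.split 43 (.leaf 142379568)
  (.split 404 (.leaf 135289647) (.split 336 (.leaf 135897624) (.leaf 138597624)))) (.leaf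
  158694237))))) (.split 208 (.split 326 (.split 274 (.leaf 134297568) (.leaf 135297864))
  (.split 168 (.split 450 (.leaf 134268975) (.leaf 135278964)) (.split 177 (.split 204 (.leaf
  126589734) (.leaf 153874926)) (.split 296 (.split 396 (.leaf 156749328) (.split 113 (.split
  170 (.leaf 126348957) (.leaf 136248957)) (.split 49 (.split 225 (.leaf 143527869) (.split 278
  (.leaf 125639478) (.leaf 152394867))) (.leaf 156849327)))) (.leaf 158649237))))) (.split 209
  (.split 164 (.split 84 (.split 396 (.leaf 124395768) (.leaf 129348675)) (.leaf 124968537))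
  (.split 166 (.split 90 (.leaf 125794638) (.split 82 (.leaf 135782694) (.leaf 127549638)))
  (.split 336 (.split 282 (.leaf 124935786) (.leaf 172594638)) (.split 172 (.split 56 (.leaf
  128349657) (.split 304 (.leaf 127589634) (.leaf 179564328))) (.split 328 (.leaf 128364957)
  (.leaf 128364975)))))) (.split 224 (.split 77 (.split 390 (.leaf 125983674) (.leaf 153298647))
  (.split 418 (.split 289 (.leaf 129638745) (.leaf 169234578)) (.split 298 (.split 273 (.leaf
  126378594) (.split 401 (.leaf 135897624) (.leaf 158746239))) (.leaf 134296857)))) (.split 298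
  (.split 28 (.split 292 (.leaf 143296785) (.leaf 126394587)) (.split 416 (.split 449 (.leaf
  124639875) (.leaf 162435789)) (.split 92 (.split 25 (.leaf 125378694) (.leaf 143296875))
  (.leaf 129687534)))) (.split 416 (.split 226 (.leaf 134926857) (.split 269 (.split 228 (.leaf
  124936857) (.leaf 124936875)) (.split 268 (.split 278 (.leaf 142396587) (.split 193 (.split
  394 (.leaf 124356789) (.leaf 153294867)) (.leaf 153294687))) (.leaf 134926875)))) (.split 418
  (.split 27 (.split 41 (.leaf 124357869) (.leaf 145789326)) (.split 292 (.split 145 (.leaf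
  125869437) (.leaf 143296785)) (.leaf 142396875))) (.leaf 134296875))))))))))))

/-- A valid decision tree for the case that the first four elements have sum zero, while no three
elements do. -/
def quadrupleTree : Tree :=
  .split 165 (.split 354 (.leaf 124538679) (.leaf 153427968)) (.split 212 (.split 120 (.leaf
  123859647) (.split 312 (.leaf 123748569) (.leaf 132875649))) (.split 228 (.split 210 (.leaf
  124578936) (.split 338 (.leaf 124579638) (.leaf 134687529))) (.split 282 (.leaf 126495783)
  (.split 344 (.leaf 142638759) (.leaf 124957836)))))

lemma check_tripleTree : tripleTree.check (fun x => close 0 x || close 7 x) = true := by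
  decide +kernel

lemma check_quadrupleTree :
    quadrupleTree.check (fun x => (close 0 x || close 15 x) || weight x ∈ [3, 6]) = true := by
  decide +kernel

lemma check_leaf :
    (Tree.leaf 123456789).check (fun x => close 0 x || weight x ∈ [3, 4, 5, 6]) = true := by
  decide +kernel

section Enumeration

/-- A finite set has an enumeration without repetition that starts with a given subset. -/
lemma exists_list_starting {α : Type*} [DecidableEq α] {A B : Finset α} (hB : B ⊆ A) :
    ∃ l : List α, l.Nodup ∧ l.toFinset = A ∧ (l.take B.card).toFinset = B := by
  refine ⟨B.toList ++ (A \ B).toList, ?_, ?_, ?_⟩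
  · refine List.Nodup.append B.nodup_toList (A \ B).nodup_toList fun x hx hx' => ?_
    exact (mem_sdiff.1 (mem_toList.1 hx')).2 (mem_toList.1 hx)
  · rw [List.toFinset_append, toList_toFinset, toList_toFinset, union_sdiff_of_subset hB]
  · rw [← length_toList, List.take_left, toList_toFinset]

variable {G : Type*} [AddCommGroup G] [DecidableEq G]

/-- The set `A` has an admissible enumeration that starts with a given subset. -/
lemma exists_admissible {A B : Finset G} (h0 : (0 : G) ∉ A)
    (hpair : ∀ x ∈ A, -x ∈ A → x = -x) (hsum : ∑ a ∈ A, a = 0) (hcard : A.card = 9)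
    (hB : B ⊆ A) :
    ∃ f : ℕ → G, Admissible f ∧ (range 9).image f = A ∧ (range B.card).image f = B := by
  obtain ⟨l, hn, hA, hlB⟩ := exists_list_starting hB
  have hlen : l.length = 9 := by rw [← List.toFinset_card_of_nodup hn, hA, hcard]
  have image_range : ∀ k ≤ 9, (range k).image (fun i => l.getD i 0) = (l.take k).toFinset := by
    intro k hk
    ext x
    simp only [mem_image, mem_range, List.mem_toFinset, List.mem_take_iff_getElem, hlen]
    constructor
    · rintro ⟨i, hi, rfl⟩
      exact ⟨i, by omega, by rw [List.getD_eq_getElem]⟩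
    · rintro ⟨i, hi, rfl⟩
      exact ⟨i, by omega, by rw [List.getD_eq_getElem]⟩
  have himage : (range 9).image (fun i => l.getD i 0) = A := by
    rw [image_range 9 le_rfl, List.take_of_length_le hlen.le, hA]
  have hmem : ∀ i ∈ range 9, l.getD i 0 ∈ A := fun i hi => himage ▸ mem_image_of_mem _ hi
  have hinj : Set.InjOn (fun i => l.getD i 0) (range 9 : Finset ℕ) := by
    rw [← card_image_iff, himage, hcard, card_range]
  refine ⟨fun i => l.getD i 0, ⟨?_, ?_, ?_, ?_⟩, himage, ?_⟩
  · exact fun i hi h => h0 (h ▸ hmem i hi)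
  · exact fun i hi j hj hij h => hij (hinj hi hj h)
  · intro i hi j hj hij h
    have hji : l.getD j 0 = -l.getD i 0 := eq_neg_of_add_eq_zero_right h
    exact hij (hinj hi hj ((hpair _ (hmem i hi) (hji ▸ hmem j hj)).trans hji.symm))
  · exact (sum_image (f := id) hinj).symm.trans (himage ▸ hsum)
  · rw [image_range _ (hcard ▸ card_le_card hB), hlB]

/-- A subset of the enumerated set has as many elements as its mask has ones. -/
lemma Admissible.exists_subset {f : ℕ → G} (hf : Admissible f) (m : ℕ) :
    ∃ B ⊆ (range 9).image f, B.card = weight m ∧ ∑ b ∈ B, b = maskSum f m := by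
  have hinj : Set.InjOn f (support m) := fun i hi j hj h => by
    by_contra hij
    exact hf.ne i (support_subset m hi) j (support_subset m hj) hij h
  exact ⟨_, image_subset_image (support_subset m), card_image_of_injOn hinj, sum_image hinj⟩

/-- If no `k` elements have sum zero, then no `9 - k` elements do. -/
lemma Admissible.ne_zero_of_weight {f : ℕ → G} (hf : Admissible f) {k : ℕ}
    (hk : ∀ B ⊆ (range 9).image f, B.card = k → ∑ b ∈ B, b ≠ 0) {m : ℕ}
    (hm : weight m = k ∨ weight m + k = 9) : maskSum f m ≠ 0 := by
  have key : ∀ m, weight m = k → maskSum f m ≠ 0 := by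
    intro m hm
    obtain ⟨B, hB, hBk, hBm⟩ := hf.exists_subset m
    exact hBm ▸ hk B hB (hBk.trans hm)
  rcases hm with hm | hm
  · exact key m hm
  · have h := weight_compl 0 m
    rw [Nat.zero_xor, Nat.zero_xor] at h
    rw [← neg_ne_zero, ← hf.maskSum_compl]
    exact key _ (by omega)

/-- An initial segment that enumerates a zero-sum set yields a mask with sum zero. -/
lemma Admissible.maskSum_eq_zero {f : ℕ → G} (hf : Admissible f) {B : Finset G} {m k : ℕ}
    (hB : (range k).image f = B) (hB0 : ∑ b ∈ B, b = 0) (hm : support m = range k) :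
    maskSum f m = 0 := by
  rw [maskSum, hm, ← hB0, ← hB, sum_image]
  intro i hi j hj h
  by_contra hij
  rw [← hm] at hi hj
  exact hf.ne i (support_subset m hi) j (support_subset m hj) hij h

/-- A suitable enumeration has a rearrangement none of whose intervals has sum zero. -/
lemma exists_simple_enumeration {A : Finset G} (h0 : (0 : G) ∉ A)
    (hpair : ∀ x ∈ A, -x ∈ A → x = -x) (hsum : ∑ a ∈ A, a = 0) (hcard : A.card = 9) :
    ∃ f : ℕ → G, Admissible f ∧ (range 9).image f = A ∧
      ∃ p : List ℕ, p.length = 9 ∧ p.Nodup ∧ (∀ i ∈ p, i < 9) ∧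
        ∀ j < 9, ∀ i < j, maskSum f (mask (interval p i j)) ≠ 0 := by
  by_cases h3 : ∃ B ⊆ A, B.card = 3 ∧ ∑ b ∈ B, b = 0
  · obtain ⟨B, hB, hB3, hB0⟩ := h3
    obtain ⟨f, hf, hfA, hfB⟩ := exists_admissible h0 hpair hsum hcard hB
    refine ⟨f, hf, hfA, hf.exists_ordering tripleTree (fun m hm => ?_) check_tripleTree⟩
    have h7 : maskSum f 7 = 0 := hf.maskSum_eq_zero hfB hB0 (by rw [hB3]; decide)
    exact (Bool.or_eq_true_iff.1 hm).elim hf.ne_zero_of_close_zero (hf.ne_zero_of_close h7)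
  push Not at h3
  by_cases h4 : ∃ B ⊆ A, B.card = 4 ∧ ∑ b ∈ B, b = 0
  · obtain ⟨B, hB, hB4, hB0⟩ := h4
    obtain ⟨f, hf, hfA, hfB⟩ := exists_admissible h0 hpair hsum hcard hB
    refine ⟨f, hf, hfA, hf.exists_ordering quadrupleTree (fun m hm => ?_) check_quadrupleTree⟩
    have h15 : maskSum f 15 = 0 := hf.maskSum_eq_zero hfB hB0 (by rw [hB4]; decide)
    simp only [Bool.or_eq_true, decide_eq_true_eq, List.mem_cons, List.not_mem_nil,
      or_false] at hm
    rcases hm with (hm | hm) | hm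
    · exact hf.ne_zero_of_close_zero hm
    · exact hf.ne_zero_of_close h15 hm
    · exact hf.ne_zero_of_weight (hfA ▸ h3) (by omega)
  push Not at h4
  obtain ⟨f, hf, hfA, -⟩ := exists_admissible h0 hpair hsum hcard subset_rfl
  refine ⟨f, hf, hfA, hf.exists_ordering _ (fun m hm => ?_) check_leaf⟩
  simp only [Bool.or_eq_true, decide_eq_true_eq, List.mem_cons, List.not_mem_nil, or_false] at hm
  rcases hm with hm | hm
  · exact hf.ne_zero_of_close_zero hm
  · obtain hm | hm : (weight m = 3 ∨ weight m + 3 = 9) ∨ (weight m = 4 ∨ weight m + 4 = 9) := by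
      omega
    · exact hf.ne_zero_of_weight (hfA ▸ h3) hm
    · exact hf.ne_zero_of_weight (hfA ▸ h4) hm

end Enumeration

lemma sum_take_succ {G : Type*} [AddCommGroup G] (f : ℕ → G) (p : List ℕ) {i j : ℕ}
    (hij : i < j) :
    ((p.map f).take (j + 1)).sum = ((p.map f).take (i + 1)).sum + ((interval p i j).map f).sum := by
  have h : p.take (j + 1) = p.take (i + 1) ++ interval p i j := by
    have h := (List.take_append_drop (i + 1) (p.take (j + 1))).symm
    rwa [List.take_take, min_eq_left (by omega)] at h
  rw [← List.map_take, ← List.map_take, h, List.map_append, List.sum_append]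

end SimpleOrdering

open SimpleOrdering in
theorem stmt_5 {G : Type*} [AddCommGroup G] [DecidableEq G] (A : Finset G)
    (h0 : (0 : G) ∉ A)
    (hpair : ∀ x ∈ A, -x ∈ A → x = -x)
    (hsum : ∑ a ∈ A, a = 0)
    (hcard : A.card = 9) :
    ∃ l : List G, l.Nodup ∧ l.toFinset = A ∧
      ∀ i j : Fin l.length,
        (l.take (i.1 + 1)).sum = (l.take (j.1 + 1)).sum → i = j := by
  obtain ⟨f, hf, hfA, p, hlen, hn, hlt, hp⟩ := exists_simple_enumeration h0 hpair hsum hcard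
  have hpr : p.toFinset = Finset.range 9 := by
    refine Finset.eq_of_subset_of_card_le (fun i hi => ?_) ?_
    · exact Finset.mem_range.2 (hlt i (List.mem_toFinset.1 hi))
    · rw [List.toFinset_card_of_nodup hn, hlen, Finset.card_range]
  have hne : ∀ i j, i < j → j < 9 →
      ((p.map f).take (i + 1)).sum ≠ ((p.map f).take (j + 1)).sum := by
    intro i j hij hj h
    have hsub : (interval p i j).Sublist p :=
      (List.drop_sublist _ _).trans (List.take_sublist _ _)
    refine hp j hj i hij ?_
    rw [maskSum_mask (fun k hk => hlt k (hsub.subset hk)) (hn.sublist hsub)]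
    rw [sum_take_succ f p hij] at h
    exact left_eq_add.1 h
  refine ⟨p.map f, ?_, ?_, fun i j h => ?_⟩
  · refine hn.map_on fun i hi j hj h => ?_
    by_contra hij
    exact hf.ne i (Finset.mem_range.2 (hlt i hi)) j (Finset.mem_range.2 (hlt j hj)) hij h
  · rw [← hfA, ← hpr]
    ext x
    simp
  · have hi : i.1 < 9 := by simpa [hlen] using i.2
    have hj : j.1 < 9 := by simpa [hlen] using j.2
    rcases lt_trichotomy i.1 j.1 with hij | hij | hij
    · exact absurd h (hne _ _ hij hj)
    · exact Fin.ext hij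
    · exact absurd h.symm (hne _ _ hij hi)
end

section
/- Let G be any (not necessarily abelian) group and let A be a subset of G \ {identity} with |A| ≤ 5. Then there exists an ordering of the elements of A such that all partial products (sums, in additive notation) are pairwise distinct. -/
section Combinatorics

variable {α : Type*} [DecidableEq α] {A : Finset α}

theorem exists_mem_notMem_of_length_lt_card {l : List α} (h : l.length < A.card) :
    ∃ v ∈ A, v ∉ l := by
  obtain ⟨v, hv, hvl⟩ := Finset.exists_mem_notMem_of_card_lt_card
    (lt_of_le_of_lt (List.toFinset_card_le l) h)
  exact ⟨v, hv, by simpa using hvl⟩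

theorem exists_nodup_cons_of_length_lt_card {l : List α} (h : l.length < A.card)
    (hl : l.Nodup) (hA : ∀ x ∈ l, x ∈ A) :
    ∃ v, (v :: l).Nodup ∧ ∀ x ∈ v :: l, x ∈ A := by
  obtain ⟨v, hv, hvl⟩ := exists_mem_notMem_of_length_lt_card h
  exact ⟨v, List.nodup_cons.2 ⟨hvl, hl⟩, List.forall_mem_cons.2 ⟨hv, hA⟩⟩

theorem toFinset_eq_of_nodup_of_length_eq_card {l : List α} (hl : l.Nodup)
    (hA : ∀ x ∈ l, x ∈ A) (h : l.length = A.card) : l.toFinset = A :=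
  Finset.eq_of_subset_of_card_le (fun x hx => hA x (List.mem_toFinset.1 hx))
    (by rw [List.toFinset_card_of_nodup hl, h])

end Combinatorics

section Group

variable {G : Type*} [Group G]

theorem mul_mul_rotate {x y z : G} (h : x * y * z = 1) : y * z * x = 1 := by
  rwa [mul_assoc, mul_eq_one_comm] at h

variable [DecidableEq G] {A : Finset G}

/-- `A` has an ordering whose partial products are pairwise distinct. -/
def HasSimpleOrdering (A : Finset G) : Prop :=
  ∃ l : List G, l.Nodup ∧ l.toFinset = A ∧
    ∀ i j : Fin l.length, (l.take (i.1 + 1)).prod = (l.take (j.1 + 1)).prod → i = j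

theorem HasSimpleOrdering.of_infix_prod_ne_one {s : List G} (hcard : s.length + 1 = A.card)
    (hs : s.Nodup) (hA : ∀ x ∈ s, x ∈ A) (hprod : ∀ u, u <:+: s → u ≠ [] → u.prod ≠ 1) :
    HasSimpleOrdering A := by
  obtain ⟨v, hv, hvA⟩ := exists_nodup_cons_of_length_lt_card (by omega) hs hA
  have key : ∀ i j : ℕ, i < j → j ≤ s.length → (s.take i).prod ≠ (s.take j).prod := by
    intro i j hij hj h
    have hsplit : s.take j = s.take i ++ (s.take j).drop i := by
      conv_lhs => rw [← List.take_append_drop i (s.take j), List.take_take, min_eq_left hij.le]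
    rw [hsplit, List.prod_append, left_eq_mul] at h
    refine hprod _ ((List.drop_suffix i _).isInfix.trans (List.take_prefix j s).isInfix) ?_ h
    rw [← List.length_pos_iff_ne_nil]
    simp only [List.length_drop, List.length_take]
    omega
  refine ⟨v :: s, hv, toFinset_eq_of_nodup_of_length_eq_card hv hvA (by simpa using hcard), ?_⟩
  rintro ⟨i, hi⟩ ⟨j, hj⟩ h
  simp only [List.length_cons] at hi hj
  simp only [List.take_succ_cons, List.prod_cons, mul_right_inj] at h
  rcases lt_trichotomy i j with hij | rfl | hij
  · exact (key i j hij (by omega) h).elim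
  · rfl
  · exact (key j i hij (by omega) h.symm).elim

theorem HasSimpleOrdering.of_card_eq_two (h1 : (1 : G) ∉ A) (hcard : A.card = 2) :
    HasSimpleOrdering A := by
  obtain ⟨x, y, hxy, rfl⟩ := Finset.card_eq_two.1 hcard
  refine .of_infix_prod_ne_one (s := [x]) (by simp [hcard]) (by simp) (by simp) fun u hu hu' => ?_
  have : u = [x] := by simpa [List.infix_cons_iff, List.prefix_cons_iff, hu'] using hu
  subst this
  simp at h1 ⊢
  tauto

theorem HasSimpleOrdering.of_pair (h1 : (1 : G) ∉ A) (hcard : A.card = 3) {x y : G}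
    (hx : x ∈ A) (hy : y ∈ A) (hxy : x ≠ y) (h : x * y ≠ 1) : HasSimpleOrdering A := by
  have hne : ∀ z ∈ A, z ≠ 1 := fun z hz hz1 => h1 (hz1 ▸ hz)
  refine .of_infix_prod_ne_one (s := [x, y]) (by simp [hcard]) (by simp [hxy]) (by simp [hx, hy])
    fun u hu hu' => ?_
  simp only [List.infix_cons_iff, List.prefix_cons_iff, List.infix_nil, List.prefix_nil] at hu
  have := hne x hx
  have := hne y hy
  rcases hu with (rfl | ⟨_, rfl, rfl | ⟨_, rfl, rfl⟩⟩) | (rfl | ⟨_, rfl, rfl⟩) | rfl <;> simp_all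

theorem HasSimpleOrdering.of_triple (h1 : (1 : G) ∉ A) (hcard : A.card = 4) {x y z : G}
    (hx : x ∈ A) (hy : y ∈ A) (hz : z ∈ A) (hnd : [x, y, z].Nodup)
    (hxy : x * y ≠ 1) (hyz : y * z ≠ 1) (hxyz : x * y * z ≠ 1) : HasSimpleOrdering A := by
  have hne : ∀ z ∈ A, z ≠ 1 := fun z hz hz1 => h1 (hz1 ▸ hz)
  refine .of_infix_prod_ne_one (s := [x, y, z]) (by simp [hcard]) hnd (by simp [hx, hy, hz])
    fun u hu hu' => ?_
  simp only [List.infix_cons_iff, List.prefix_cons_iff, List.infix_nil, List.prefix_nil] at hu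
  have := hne x hx
  have := hne y hy
  have := hne z hz
  rcases hu with (rfl | ⟨_, rfl, rfl | ⟨_, rfl, rfl | ⟨_, rfl, rfl⟩⟩⟩) |
    (rfl | ⟨_, rfl, rfl | ⟨_, rfl, rfl⟩⟩) | (rfl | ⟨_, rfl, rfl⟩) | rfl <;> simp_all [mul_assoc]

theorem HasSimpleOrdering.of_quadruple (h1 : (1 : G) ∉ A) (hcard : A.card = 5) {w x y z : G}
    (hw : w ∈ A) (hx : x ∈ A) (hy : y ∈ A) (hz : z ∈ A) (hnd : [w, x, y, z].Nodup)
    (hwx : w * x ≠ 1) (hxy : x * y ≠ 1) (hyz : y * z ≠ 1)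
    (hwxy : w * x * y ≠ 1) (hxyz : x * y * z ≠ 1) (hwxyz : w * x * y * z ≠ 1) :
    HasSimpleOrdering A := by
  have hne : ∀ z ∈ A, z ≠ 1 := fun z hz hz1 => h1 (hz1 ▸ hz)
  refine .of_infix_prod_ne_one (s := [w, x, y, z]) (by simp [hcard]) hnd (by simp [hw, hx, hy, hz])
    fun u hu hu' => ?_
  simp only [List.infix_cons_iff, List.prefix_cons_iff, List.infix_nil, List.prefix_nil] at hu
  have := hne w hw
  have := hne x hx
  have := hne y hy
  have := hne z hz
  rcases hu with (rfl | ⟨_, rfl, rfl | ⟨_, rfl, rfl | ⟨_, rfl, rfl | ⟨_, rfl, rfl⟩⟩⟩⟩) |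
    (rfl | ⟨_, rfl, rfl | ⟨_, rfl, rfl | ⟨_, rfl, rfl⟩⟩⟩) |
    (rfl | ⟨_, rfl, rfl | ⟨_, rfl, rfl⟩⟩) | (rfl | ⟨_, rfl, rfl⟩) | rfl <;> simp_all [mul_assoc]

theorem HasSimpleOrdering.of_card_eq_three (h1 : (1 : G) ∉ A) (hcard : A.card = 3) :
    HasSimpleOrdering A := by
  obtain ⟨x, y, z, hxy, hxz, hyz, rfl⟩ := Finset.card_eq_three.1 hcard
  by_cases h : x * y = 1
  · refine .of_pair h1 hcard (x := x) (y := z) (by simp) (by simp) hxz fun h' => hyz ?_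
    exact mul_left_cancel (h.trans h'.symm)
  · exact .of_pair h1 hcard (by simp) (by simp) hxy h

theorem HasSimpleOrdering.of_card_eq_four (h1 : (1 : G) ∉ A) (hcard : A.card = 4) :
    HasSimpleOrdering A := by
  have hne : ∀ z ∈ A, z ≠ 1 := fun z hz hz1 => h1 (hz1 ▸ hz)
  obtain ⟨x, y, z, w, hxy, hxz, hxw, hyz, hyw, hzw, rfl⟩ := Finset.card_eq_four.1 hcard
  by_cases hinv : ∃ p ∈ ({x, y, z, w} : Finset G), ∃ q ∈ ({x, y, z, w} : Finset G),
      p ≠ q ∧ p * q = 1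
  · obtain ⟨p, hp, q, hq, hpq, h⟩ := hinv
    obtain ⟨b, hb, hbA⟩ := exists_nodup_cons_of_length_lt_card (l := [p, q])
      (A := {x, y, z, w}) (by simp [hcard]) (by simp [hpq]) (by simp at hp hq ⊢; tauto)
    simp only [List.forall_mem_cons] at hbA
    simp at hb
    obtain rfl := eq_inv_of_mul_eq_one_right h
    refine .of_triple h1 hcard hp hbA.1 hq (by simp; tauto) ?_ ?_ ?_
    · intro h'; exact hb.1.2 (eq_inv_of_mul_eq_one_right h')
    · intro h'; exact hb.1.1 (mul_inv_eq_one.1 h')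
    · intro h'; exact hne b hbA.1 (conj_eq_one_iff.1 h')
  · push Not at hinv
    by_cases h : x * y * z = 1
    · refine .of_triple h1 hcard (x := x) (y := y) (z := w) (by simp) (by simp) (by simp)
        (by simp; tauto) (hinv _ (by simp) _ (by simp) hxy) (hinv _ (by simp) _ (by simp) hyw)
        fun h' => hzw (mul_left_cancel (h.trans h'.symm))
    · exact .of_triple h1 hcard (x := x) (y := y) (z := z) (by simp) (by simp) (by simp)
        (by simp; tauto) (hinv _ (by simp) _ (by simp) hxy) (hinv _ (by simp) _ (by simp) hyz) h

section CardFive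

theorem mul_eq_of_not_hasSimpleOrdering (h1 : (1 : G) ∉ A) (hcard : A.card = 5)
    (hA : ¬ HasSimpleOrdering A) {p q b c : G} (hmem : ∀ x ∈ [p, b, c, q], x ∈ A)
    (hnd : [p, b, c, q].Nodup) (hpq : p * q = 1) (hbc : b * c ≠ 1) : b * c = p ∨ b * c = q := by
  simp only [List.forall_mem_cons] at hmem
  simp at hnd
  by_contra! h
  obtain rfl := eq_inv_of_mul_eq_one_right hpq
  refine hA (.of_quadruple h1 hcard hmem.1 hmem.2.1 hmem.2.2.1 hmem.2.2.2.1 (by simp; tauto)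
    ?_ hbc ?_ ?_ ?_ ?_)
  · exact fun h' => hnd.2.1.2 (eq_inv_of_mul_eq_one_right h')
  · exact fun h' => hnd.1.2.1 (mul_inv_eq_one.1 h').symm
  · rw [mul_assoc]
    exact fun h' => h.2 (eq_inv_of_mul_eq_one_right h')
  · exact fun h' => h.1 (mul_inv_eq_one.1 h')
  · rw [mul_assoc p]
    exact fun h' => hbc (conj_eq_one_iff.1 h')

theorem HasSimpleOrdering.of_two_inverse_pairs_of_mul_eq (h1 : (1 : G) ∉ A) (hcard : A.card = 5)
    {p q r s c : G} (hmem : ∀ x ∈ [p, q, r, s, c], x ∈ A) (hnd : [p, q, r, s, c].Nodup)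
    (hpq : p * q = 1) (hrs : r * s = 1) (hrc : r * c = p) (hsc : s * c = q) :
    HasSimpleOrdering A := by
  have hne : ∀ z ∈ A, z ≠ 1 := fun z hz hz1 => h1 (hz1 ▸ hz)
  simp only [List.forall_mem_cons] at hmem
  simp at hnd
  have hr : r = s⁻¹ := eq_inv_of_mul_eq_one_left hrs
  have hp : p = q⁻¹ := eq_inv_of_mul_eq_one_left hpq
  have hc : c = s * p := by rw [← hrc, hr]; group
  have hss : s * s = q * q := by
    rw [hc, hp, ← mul_assoc, mul_inv_eq_iff_eq_mul] at hsc
    exact hsc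
  refine .of_quadruple h1 hcard (w := p) (x := c) (y := q) (z := s) hmem.1 hmem.2.2.2.2.1
    hmem.2.1 hmem.2.2.2.1 (by simp; tauto) ?_ ?_ ?_ ?_ ?_ ?_
  · intro h
    exact hnd.2.1.2.2 (mul_left_cancel (hpq.trans h.symm))
  · intro h
    exact hnd.1.2.2.2 (mul_right_cancel (hpq.trans h.symm))
  · intro h
    exact hnd.2.1.1 (mul_right_cancel (h.trans hrs.symm))
  · intro h
    refine hne c hmem.2.2.2.2.1 (conj_eq_one_iff (a := p).1 ?_)
    rwa [← eq_inv_of_mul_eq_one_right hpq]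
  · intro h
    rw [hc, mul_assoc s, hpq, mul_one] at h
    exact hnd.2.2.1.1 (mul_right_cancel (hrs.trans h.symm))
  · intro h
    refine hne q hmem.2.1 ?_
    rwa [hc, mul_assoc p, mul_assoc s, hpq, mul_one, mul_assoc, hss, ← mul_assoc, hpq,
      one_mul] at h

theorem HasSimpleOrdering.of_two_inverse_pairs (h1 : (1 : G) ∉ A) (hcard : A.card = 5)
    {p q r s c : G} (hmem : ∀ x ∈ [p, q, r, s, c], x ∈ A) (hnd : [p, q, r, s, c].Nodup)
    (hpq : p * q = 1) (hrs : r * s = 1) : HasSimpleOrdering A := by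
  by_contra hA
  have hrc := mul_eq_of_not_hasSimpleOrdering h1 hcard hA (p := p) (q := q) (b := r) (c := c)
    (by simp at hmem ⊢; tauto) (by grind) hpq
    fun h => by simp at hnd; exact hnd.2.2.2 (mul_left_cancel (hrs.trans h.symm))
  have hsc := mul_eq_of_not_hasSimpleOrdering h1 hcard hA (p := p) (q := q) (b := s) (c := c)
    (by simp at hmem ⊢; tauto) (by grind) hpq
    fun h => by
      simp at hnd
      exact hnd.2.2.1.2 (mul_left_cancel ((mul_eq_one_comm.1 hrs).trans h.symm))
  have hne : r * c ≠ s * c := fun h => by simp at hnd h; tauto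
  rcases hrc with hrc | hrc <;> rcases hsc with hsc | hsc
  · exact hne (hrc.trans hsc.symm)
  · exact hA (.of_two_inverse_pairs_of_mul_eq h1 hcard hmem hnd hpq hrs hrc hsc)
  · exact hA (.of_two_inverse_pairs_of_mul_eq h1 hcard (p := q) (q := p)
      (by simp at hmem ⊢; tauto) (by grind) (mul_eq_one_comm.1 hpq) hrs hrc hsc)
  · exact hne (hrc.trans hsc.symm)

theorem HasSimpleOrdering.of_cyclic_mul_eq (h1 : (1 : G) ∉ A) (hcard : A.card = 5)
    {p q a b c : G} (hmem : ∀ x ∈ [p, q, a, b, c], x ∈ A) (hnd : [p, q, a, b, c].Nodup)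
    (hpq : p * q = 1) (hab : a * b = p) (hbc : b * c = p) (hca : c * a = p) :
    HasSimpleOrdering A := by
  have hne : ∀ z ∈ A, z ≠ 1 := fun z hz hz1 => h1 (hz1 ▸ hz)
  simp only [List.forall_mem_cons] at hmem
  simp at hnd
  have hp := hne p hmem.1
  have hinv : ∀ x, x ≠ q → p * x ≠ 1 := fun x hx h => hx (mul_left_cancel (h.trans hpq.symm))
  have key : ∀ x y z, x ∈ A → y ∈ A → z ∈ A → [p, x, y, z].Nodup → x ≠ q → z ≠ q →
      x * y = p → y * z = p → p * p * z ≠ 1 → HasSimpleOrdering A := by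
    intro x y z hx hy hz hxyz hxq hzq hxy hyz h
    refine .of_quadruple h1 hcard hmem.1 hx hy hz hxyz (hinv x hxq) (hxy ▸ hp) (hyz ▸ hp)
      ?_ ?_ ?_
    · rw [mul_assoc, hxy]
      exact hinv p hnd.1.1
    · rw [hxy]
      exact hinv z hzq
    · rwa [mul_assoc p, hxy]
  by_cases h : p * p * c = 1
  · refine key b c a hmem.2.2.2.1 hmem.2.2.2.2.1 hmem.2.2.1 (by simp; tauto) (by tauto) (by tauto)
      hbc hca fun h' => hnd.2.2.1.2 (mul_left_cancel (h'.trans h.symm))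
  · exact key a b c hmem.2.2.1 hmem.2.2.2.1 hmem.2.2.2.2.1 (by simp; tauto) (by tauto) (by tauto)
      hab hbc h

theorem HasSimpleOrdering.of_unique_inverse_pair (h1 : (1 : G) ∉ A) (hcard : A.card = 5)
    {p q a b c : G} (hmem : ∀ x ∈ [p, q, a, b, c], x ∈ A) (hnd : [p, q, a, b, c].Nodup)
    (hpq : p * q = 1)
    (hinv : ∀ r ∈ [a, b, c], ∀ s ∈ [a, b, c], r ≠ s → r * s ≠ 1) : HasSimpleOrdering A := by
  by_contra hA
  have key : ∀ r ∈ [a, b, c], ∀ s ∈ [a, b, c], r ≠ s → r * s = p ∨ r * s = q := by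
    intro r hr s hs hrs
    refine mul_eq_of_not_hasSimpleOrdering h1 hcard hA ?_ ?_ hpq (hinv r hr s hs hrs) <;>
      clear * - hr hs hrs hmem hnd <;> grind
  have hnd' := hnd
  simp at hnd'
  obtain ⟨-, -, ⟨hab, hac⟩, hbc⟩ := hnd'
  have habac : a * b ≠ a * c := fun h => hbc (mul_left_cancel h)
  have hacbc : a * c ≠ b * c := fun h => hab (mul_right_cancel h)
  have hbabc : b * a ≠ b * c := fun h => hac (mul_left_cancel h)
  have hbaca : b * a ≠ c * a := fun h => hbc (mul_right_cancel h)
  have hkab := key a (by simp) b (by simp) hab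
  have hkac := key a (by simp) c (by simp) hac
  have hkbc := key b (by simp) c (by simp) hbc
  have hkca := key c (by simp) a (by simp) (Ne.symm hac)
  have hkba := key b (by simp) a (by simp) (Ne.symm hab)
  have hcycle : ∀ p' q', (∀ g, g = p ∨ g = q → g = p' ∨ g = q') → a * b = p' →
      b * c = p' ∧ c * a = p' := by
    intro p' q' hpq' hab
    have hac := hpq' _ hkac
    have hbc := hpq' _ hkbc
    have hca := hpq' _ hkca
    have hba := hpq' _ hkba
    clear * - habac hacbc hbabc hbaca hab hac hbc hca hba
    grind
  rcases hkab with hab | hab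
  · obtain ⟨hbc, hca⟩ := hcycle p q (fun _ => id) hab
    exact hA (.of_cyclic_mul_eq h1 hcard hmem hnd hpq hab hbc hca)
  · obtain ⟨hbc, hca⟩ := hcycle q p (fun _ => Or.symm) hab
    exact hA (.of_cyclic_mul_eq h1 hcard (p := q) (q := p)
      (fun x hx => hmem x (by clear * - hx; grind)) (by clear * - hnd; grind)
      (mul_eq_one_comm.1 hpq) hab hbc hca)

section NoInversePair

theorem mul_mul_mul_eq_one_of_not_hasSimpleOrdering (h1 : (1 : G) ∉ A) (hcard : A.card = 5)
    (hA : ¬ HasSimpleOrdering A) (hinv : ∀ p ∈ A, ∀ q ∈ A, p ≠ q → p * q ≠ 1) {w x y z : G}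
    (hmem : ∀ v ∈ [w, x, y, z], v ∈ A) (hnd : [w, x, y, z].Nodup) (hwxy : w * x * y ≠ 1)
    (hxyz : x * y * z ≠ 1) : w * x * y * z = 1 := by
  by_contra hwxyz
  simp only [List.forall_mem_cons] at hmem
  obtain ⟨hw, hx, hy, hz, -⟩ := hmem
  refine hA (.of_quadruple h1 hcard hw hx hy hz hnd (hinv _ hw _ hx ?_) (hinv _ hx _ hy ?_)
    (hinv _ hy _ hz ?_) hwxy hxyz hwxyz) <;> simp at hnd <;> tauto

theorem exists_mul_mul_eq_one_of_not_hasSimpleOrdering (h1 : (1 : G) ∉ A) (hcard : A.card = 5)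
    (hA : ¬ HasSimpleOrdering A) (hinv : ∀ p ∈ A, ∀ q ∈ A, p ≠ q → p * q ≠ 1) {x y : G}
    (hx : x ∈ A) (hy : y ∈ A) (hxy : x ≠ y) : ∃ t ∈ A, t ≠ x ∧ t ≠ y ∧ x * y * t = 1 := by
  by_contra! h
  obtain ⟨u, hu, huA⟩ := exists_nodup_cons_of_length_lt_card (l := [x, y]) (A := A)
    (by simp [hcard]) (by simp [hxy]) (by simp [hx, hy])
  obtain ⟨v, hv, hvA⟩ := exists_nodup_cons_of_length_lt_card (by simp [hcard]) hu huA
  obtain ⟨w, hw, hwA⟩ := exists_nodup_cons_of_length_lt_card (by simp [hcard]) hv hvA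
  have hnd := hw
  simp at hw hwA
  have hnot : u * x * y ≠ 1 := fun h' =>
    h u (by tauto) (by tauto) (by tauto) (mul_mul_rotate h')
  have huv := mul_mul_mul_eq_one_of_not_hasSimpleOrdering h1 hcard hA hinv
    (w := u) (x := x) (y := y) (z := v) (by simp; tauto) (by clear * - hnd; grind) hnot
    (h v (by tauto) (by tauto) (by tauto))
  have huw := mul_mul_mul_eq_one_of_not_hasSimpleOrdering h1 hcard hA hinv
    (w := u) (x := x) (y := y) (z := w) (by simp; tauto) (by clear * - hnd; grind) hnot
    (h w (by tauto) (by tauto) (by tauto))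
  exact hw.1.1 (mul_left_cancel (huw.trans huv.symm))

theorem mul_eq_of_mul_mul_eq_one_of_not_hasSimpleOrdering (h1 : (1 : G) ∉ A)
    (hcard : A.card = 5) (hA : ¬ HasSimpleOrdering A)
    (hinv : ∀ p ∈ A, ∀ q ∈ A, p ≠ q → p * q ≠ 1) {x y t z w : G}
    (hmem : ∀ v ∈ [x, y, t, z, w], v ∈ A) (hnd : [x, y, t, z, w].Nodup) (h : x * y * t = 1) :
    w * z = t := by
  have hnd' := hnd
  simp at hmem hnd
  have huniq : ∀ v, v ≠ t → x * y * v ≠ 1 := fun v hv h' =>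
    hv (mul_left_cancel (h'.trans h.symm))
  have h' := mul_mul_mul_eq_one_of_not_hasSimpleOrdering h1 hcard hA hinv
    (w := z) (x := x) (y := y) (z := w) (by simp; tauto) (by clear * - hnd'; grind)
    (fun h' => huniq z (by tauto) (mul_mul_rotate h')) (huniq w (by tauto))
  rw [mul_assoc z] at h'
  have := mul_mul_rotate h'
  rw [mul_assoc] at this
  exact mul_left_cancel (this.trans h.symm)

theorem mul_self_eq_one_of_not_hasSimpleOrdering (h1 : (1 : G) ∉ A) (hcard : A.card = 5)
    (hA : ¬ HasSimpleOrdering A) (hinv : ∀ p ∈ A, ∀ q ∈ A, p ≠ q → p * q ≠ 1) {x y t : G}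
    (hmem : ∀ v ∈ [x, y, t], v ∈ A) (hnd : [x, y, t].Nodup) (h : x * y * t = 1) :
    t * t = 1 := by
  obtain ⟨z, hz, hzA⟩ := exists_nodup_cons_of_length_lt_card (by simp [hcard]) hnd hmem
  obtain ⟨w, hw, hwA⟩ := exists_nodup_cons_of_length_lt_card (by simp [hcard]) hz hzA
  have hwz := mul_eq_of_mul_mul_eq_one_of_not_hasSimpleOrdering h1 hcard hA hinv
    (x := x) (y := y) (t := t) (z := z) (w := w) (by simp at hwA ⊢; tauto)
    (by clear * - hw; grind) h
  simp at hw hwA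
  obtain ⟨t', ht', -, -, h'⟩ := exists_mul_mul_eq_one_of_not_hasSimpleOrdering h1 hcard hA hinv
    (x := w) (y := z) (by tauto) (by tauto) (by tauto)
  rw [hwz] at h'
  by_cases htt : t = t'
  · rwa [← htt] at h'
  · exact (hinv t (by tauto) t' ht' htt h').elim

theorem HasSimpleOrdering.of_no_inverse_pair (h1 : (1 : G) ∉ A) (hcard : A.card = 5)
    (hinv : ∀ p ∈ A, ∀ q ∈ A, p ≠ q → p * q ≠ 1) : HasSimpleOrdering A := by
  by_contra hA
  obtain ⟨x, hx⟩ : A.Nonempty := Finset.card_pos.1 (by omega)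
  obtain ⟨y, hy, hyx⟩ := exists_mem_notMem_of_length_lt_card (l := [x]) (A := A) (by simp [hcard])
  simp at hyx
  obtain ⟨t, ht, htx, hty, hxyt⟩ := exists_mul_mul_eq_one_of_not_hasSimpleOrdering h1 hcard hA
    hinv hx hy (Ne.symm hyx)
  obtain ⟨z, hz, hzA⟩ := exists_nodup_cons_of_length_lt_card (l := [x, y, t]) (A := A)
    (by simp [hcard]) (by simp; tauto) (by simp [hx, hy, ht])
  obtain ⟨w, hw, hwA⟩ := exists_nodup_cons_of_length_lt_card (by simp [hcard]) hz hzA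
  have hall := toFinset_eq_of_nodup_of_length_eq_card hw hwA (by simp [hcard])
  have hzw := mul_eq_of_mul_mul_eq_one_of_not_hasSimpleOrdering h1 hcard hA hinv
    (x := x) (y := y) (t := t) (z := w) (w := z) (by simp at hwA ⊢; tauto)
    (by clear * - hw; grind) hxyt
  simp at hw hwA
  have hsq : ∀ a b c : G, [a, b, c] ⊆ [x, y, t] → [a, b, c].Nodup → a * b * c = 1 → c * c = 1 :=
    fun a b c hsub hnd h => mul_self_eq_one_of_not_hasSimpleOrdering h1 hcard hA hinv
      (fun v hv => by have := hsub hv; simp at this; rcases this with rfl | rfl | rfl <;> assumption)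
      hnd h
  have htt := hsq x y t (by simp) (by simp; tauto) hxyt
  have hxx := hsq y t x (by simp) (by simp; tauto) (mul_mul_rotate hxyt)
  have hyy := hsq t x y (by simp) (by simp; tauto) (mul_mul_rotate (mul_mul_rotate hxyt))
  have hyxt : y * x = t := by
    rw [eq_inv_of_mul_eq_one_left hyy, eq_inv_of_mul_eq_one_left hxx, ← mul_inv_rev]
    exact inv_eq_of_mul_eq_one_right hxyt
  obtain ⟨u, hu, hux, huz, hxzu⟩ := exists_mul_mul_eq_one_of_not_hasSimpleOrdering h1 hcard hA
    hinv (x := x) (y := z) hx (by tauto) (by tauto)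
  rw [← hall] at hu
  simp at hu
  obtain rfl | rfl | rfl : u = w ∨ u = y ∨ u = t := by tauto
  · rw [mul_assoc, hzw] at hxzu
    exact hinv x hx t ht (Ne.symm htx) hxzu
  · have := mul_mul_rotate hxzu
    rw [mul_assoc, hyxt] at this
    exact hinv z (by tauto) t ht (by tauto) this
  · have : z = y := mul_left_cancel (mul_right_cancel (hxzu.trans hxyt.symm))
    tauto

end NoInversePair

theorem HasSimpleOrdering.of_card_eq_five (h1 : (1 : G) ∉ A) (hcard : A.card = 5) :
    HasSimpleOrdering A := by
  by_cases hinv : ∀ p ∈ A, ∀ q ∈ A, p ≠ q → p * q ≠ 1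
  · exact .of_no_inverse_pair h1 hcard hinv
  push Not at hinv
  obtain ⟨p, hp, q, hq, hpq, h⟩ := hinv
  by_cases hinv' : ∃ r ∈ A, ∃ s ∈ A, [p, q, r, s].Nodup ∧ r * s = 1
  · obtain ⟨r, hr, s, hs, hnd, h'⟩ := hinv'
    obtain ⟨c, hc, hcA⟩ := exists_nodup_cons_of_length_lt_card (by simp [hcard]) hnd
      (A := A) (by simp [hp, hq, hr, hs])
    exact .of_two_inverse_pairs h1 hcard (c := c) (by simp at hcA ⊢; tauto) (by clear * - hc; grind) h h'
  · obtain ⟨a, ha, haA⟩ := exists_nodup_cons_of_length_lt_card (l := [p, q]) (A := A)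
      (by simp [hcard]) (by simp [hpq]) (by simp [hp, hq])
    obtain ⟨b, hb, hbA⟩ := exists_nodup_cons_of_length_lt_card (by simp [hcard]) ha haA
    obtain ⟨c, hc, hcA⟩ := exists_nodup_cons_of_length_lt_card (by simp [hcard]) hb hbA
    refine .of_unique_inverse_pair h1 hcard (a := a) (b := b) (c := c) (by simp at hcA ⊢; tauto)
      (by clear * - hc; grind) h fun r hr s hs hrs h' => hinv' ⟨r, by clear * - hr hcA; grind, s,
        by clear * - hs hcA; grind, by clear * - hc hr hs hrs; grind, h'⟩

end CardFive

theorem HasSimpleOrdering.of_card_le_five (h1 : (1 : G) ∉ A) (hcard : A.card ≤ 5) :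
    HasSimpleOrdering A := by
  obtain h | h | h | h | h | h : A.card = 0 ∨ A.card = 1 ∨ A.card = 2 ∨ A.card = 3 ∨
      A.card = 4 ∨ A.card = 5 := by omega
  · obtain rfl := Finset.card_eq_zero.1 h
    exact ⟨[], by simp⟩
  · exact .of_infix_prod_ne_one (s := []) (by simp [h]) (by simp) (by simp) (by simp)
  · exact .of_card_eq_two h1 h
  · exact .of_card_eq_three h1 h
  · exact .of_card_eq_four h1 h
  · exact .of_card_eq_five h1 h

end Group

theorem stmt_13 {G : Type*} [Group G] [DecidableEq G] (A : Finset G)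
    (h1 : (1 : G) ∉ A) (hcard : A.card ≤ 5) :
    ∃ l : List G, l.Nodup ∧ l.toFinset = A ∧
      ∀ i j : Fin l.length,
        (l.take (i.1 + 1)).prod = (l.take (j.1 + 1)).prod → i = j := by
  exact HasSimpleOrdering.of_card_le_five h1 hcard
end
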